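/- arXiv:2509.20306 — 3 statements merged into one kernel-verified Lean document; each statement's English description precedes it below -/
import Mathlib

section
/- Let η, f : ℝ⁴ × ℝ → ℝ, where the first factor ℝ⁴ collects the flight variables (v, ρ, h, r) and the second factor is the azimuthal angle φ. Assume: (i) for every fixed azimuth φ, the map x ↦ η(x, φ) is noise-monotone; (ii) f is of the form f(x, φ) = g(x) for a noise-monotone function g : ℝ⁴ → ℝ (a sector-specific model evaluated at a fixed representative azimuth φ̃); (iii) bounded azimuthal variation on a sector Φ ⊆ ℝ with representative point φ̃ ∈ Φ and tolerance μ > 0: for all x ∈ ℝ⁴ and all φ ∈ Φ, |η(x, φ) − η(x, φ̃)| ≤ μ. Let a, b ∈ ℝ⁴ with a ⪯ b, and set C = (η(a, φ̃) + η(b, φ̃))/2 and D = (g(a) + g(b))/2. Then for every x ∈ ℝ⁴ with a ⪯ x ⪯ b and every φ ∈ Φ, one has |η(x, φ) − g(x)| ≤ μ + max_{w ∈ {a, b}} ( |η(w, φ̃) − C| + |g(w) − D| ) + |C − D|. -/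
/-- The noise order on flight variables `(v, ρ, h, r)`:
`x ⪯ y` iff `v ≤ v′`, `ρ ≤ ρ′`, `h ≥ h′`, `r ≥ r′`. -/
def NoisePre (x y : ℝ × ℝ × ℝ × ℝ) : Prop :=
  x.1 ≤ y.1 ∧ x.2.1 ≤ y.2.1 ∧ y.2.2.1 ≤ x.2.2.1 ∧ y.2.2.2 ≤ x.2.2.2

/-- A function `g : ℝ⁴ → ℝ` is noise-monotone if `x ⪯ y` implies `g x ≤ g y`. -/
def NoiseMono (g : ℝ × ℝ × ℝ × ℝ → ℝ) : Prop :=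
  ∀ x y, NoisePre x y → g x ≤ g y

/-- Single-hypercube core of the certified error bound (Theorem 1 of the paper). -/
theorem stmt0
    (η f : ℝ × ℝ × ℝ × ℝ → ℝ → ℝ) (g : ℝ × ℝ × ℝ × ℝ → ℝ)
    (hη : ∀ φ : ℝ, NoiseMono (fun x => η x φ))
    (hg : NoiseMono g)
    (hf : ∀ x φ, f x φ = g x)
    (Φ : Set ℝ) (φt : ℝ) (hφt : φt ∈ Φ) (μ : ℝ) (hμ : 0 < μ)
    (hvar : ∀ x : ℝ × ℝ × ℝ × ℝ, ∀ φ ∈ Φ, |η x φ - η x φt| ≤ μ)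
    (a b : ℝ × ℝ × ℝ × ℝ) (hab : NoisePre a b)
    (C D : ℝ)
    (hC : C = (η a φt + η b φt) / 2)
    (hD : D = (g a + g b) / 2) :
    ∀ x : ℝ × ℝ × ℝ × ℝ, NoisePre a x → NoisePre x b → ∀ φ ∈ Φ,
      |η x φ - g x| ≤
        μ + max (|η a φt - C| + |g a - D|) (|η b φt - C| + |g b - D|) + |C - D| := by
  intro x hax hxb φ hφ
  have h₁ : η a φt ≤ η x φt := hη φt a x hax
  have h₂ : η x φt ≤ η b φt := hη φt x b hxb
  have h₃ : |η x φt - C| ≤ |η b φt - C| :=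
    (abs_le.mpr ⟨by linarith, by linarith⟩ : |η x φt - C| ≤ η b φt - C).trans (le_abs_self _)
  have h₄ : g a ≤ g x := hg a x hax
  have h₅ : g x ≤ g b := hg x b hxb
  have h₆ : |g x - D| ≤ |g b - D| :=
    (abs_le.mpr ⟨by linarith, by linarith⟩ : |g x - D| ≤ g b - D).trans (le_abs_self _)
  have h_max := le_max_right (|η a φt - C| + |g a - D|) (|η b φt - C| + |g b - D|)
  have h_split := abs_sub_le (η x φ) (η x φt) (g x)
  have h_center := abs_sub_le (η x φt) C (g x)
  have h_model := abs_sub_le C D (g x)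
  rw [abs_sub_comm D (g x)] at h_model
  linarith [hvar x φ hφ]
end

section
/- Let η, f : ℝ⁴ → ℝ both be noise-monotone. Fix finite grids v₁ ≤ v₂ ≤ … ≤ v_I, ρ₁ ≤ ρ₂ ≤ … ≤ ρ_J, h₁ ≥ h₂ ≥ … ≥ h_K, and r₁ ≥ r₂ ≥ … ≥ r_L of real numbers, and for each index (i, j, k, ℓ) with 1 ≤ i < I, 1 ≤ j < J, 1 ≤ k < K, 1 ≤ ℓ < L, let the grid cell H^{ijkℓ} be the set of x ∈ ℝ⁴ with a^{ijkℓ} ⪯ x ⪯ b^{ijkℓ}, where a^{ijkℓ} = (v_i, ρ_j, h_{k+1}, r_{ℓ+1}) and b^{ijkℓ} = (v_{i+1}, ρ_{j+1}, h_k, r_ℓ). Set C^{ijkℓ} = (η(a^{ijkℓ}) + η(b^{ijkℓ}))/2 and D^{ijkℓ} = (f(a^{ijkℓ}) + f(b^{ijkℓ}))/2. Then for every x belonging to the union of all grid cells, |η(x) − f(x)| ≤ max over all cell indices (i, j, k, ℓ) and over w ∈ {a^{ijkℓ}, b^{ijkℓ}} of ( |η(w) − C^{ijkℓ}| + |f(w)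 − D^{ijkℓ}| + |C^{ijkℓ} − D^{ijkℓ}| ). -/
/-- A point of `[p, q]` is at least as close to the midpoint as the endpoint `p`. -/
theorem abs_sub_midpoint_le {p q t : ℝ} (hp : p ≤ t) (hq : t ≤ q) :
    |t - (p + q) / 2| ≤ |p - (p + q) / 2| := by
  rw [abs_of_nonpos (by linarith : p - (p + q) / 2 ≤ 0), abs_le]
  constructor <;> linarith

/-- The values of finitely many pairs of functions over a box of natural indices
form a set that is bounded above. -/
theorem bddAbove_box_values {α : Type*} (I J K L : ℕ) (a b : ℕ → ℕ → ℕ → ℕ → α)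
    (F : ℕ → ℕ → ℕ → ℕ → α → ℝ) :
    BddAbove {e : ℝ | ∃ i j k l, 1 ≤ i ∧ i < I ∧ 1 ≤ j ∧ j < J ∧ 1 ≤ k ∧ k < K ∧
      1 ≤ l ∧ l < L ∧ ∃ w, (w = a i j k l ∨ w = b i j k l) ∧ e = F i j k l w} := by
  have hfin : (Set.Iio I ×ˢ Set.Iio J ×ˢ Set.Iio K ×ˢ Set.Iio L).Finite :=
    (Set.finite_Iio I).prod ((Set.finite_Iio J).prod
      ((Set.finite_Iio K).prod (Set.finite_Iio L)))
  refine (((hfin.image fun p => F p.1 p.2.1 p.2.2.1 p.2.2.2 (a p.1 p.2.1 p.2.2.1 p.2.2.2)).union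
    (hfin.image fun p => F p.1 p.2.1 p.2.2.1 p.2.2.2
      (b p.1 p.2.1 p.2.2.1 p.2.2.2))).subset ?_).bddAbove
  rintro e ⟨i, j, k, l, -, hi, -, hj, -, hk, -, hl, w, rfl | rfl, rfl⟩
  · exact Or.inl ⟨(i, j, k, l), ⟨hi, hj, hk, hl⟩, rfl⟩
  · exact Or.inr ⟨(i, j, k, l), ⟨hi, hj, hk, hl⟩, rfl⟩

/-- Grid (full test-dataset) form of the paper's Theorem 1 at a fixed azimuth. -/
theorem stmt1
    (η f : ℝ × ℝ × ℝ × ℝ → ℝ) (hη : NoiseMono η) (hf : NoiseMono f)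
    (I J K L : ℕ) (v ρ h r : ℕ → ℝ)
    (hv : ∀ i, 1 ≤ i → i < I → v i ≤ v (i + 1))
    (hρ : ∀ j, 1 ≤ j → j < J → ρ j ≤ ρ (j + 1))
    (hh : ∀ k, 1 ≤ k → k < K → h (k + 1) ≤ h k)
    (hr : ∀ l, 1 ≤ l → l < L → r (l + 1) ≤ r l)
    (a b : ℕ → ℕ → ℕ → ℕ → ℝ × ℝ × ℝ × ℝ)
    (ha : ∀ i j k l, a i j k l = (v i, ρ j, h (k + 1), r (l + 1)))
    (hb : ∀ i j k l, b i j k l = (v (i + 1), ρ (j + 1), h k, r l))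
    (C D : ℕ → ℕ → ℕ → ℕ → ℝ)
    (hC : ∀ i j k l, C i j k l = (η (a i j k l) + η (b i j k l)) / 2)
    (hD : ∀ i j k l, D i j k l = (f (a i j k l) + f (b i j k l)) / 2)
    (x : ℝ × ℝ × ℝ × ℝ)
    (hx : ∃ i j k l, 1 ≤ i ∧ i < I ∧ 1 ≤ j ∧ j < J ∧ 1 ≤ k ∧ k < K ∧ 1 ≤ l ∧ l < L ∧
      NoisePre (a i j k l) x ∧ NoisePre x (b i j k l)) :
    |η x - f x| ≤
      sSup {e : ℝ | ∃ i j k l, 1 ≤ i ∧ i < I ∧ 1 ≤ j ∧ j < J ∧ 1 ≤ k ∧ k < K ∧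
        1 ≤ l ∧ l < L ∧ ∃ w : ℝ × ℝ × ℝ × ℝ, (w = a i j k l ∨ w = b i j k l) ∧
        e = |η w - C i j k l| + |f w - D i j k l| + |C i j k l - D i j k l|} := by
  obtain ⟨i, j, k, l, hi, hi', hj, hj', hk, hk', hl, hl', hax, hxb⟩ := hx
  refine le_trans ?_ (le_csSup (bddAbove_box_values I J K L a b fun i j k l w =>
    |η w - C i j k l| + |f w - D i j k l| + |C i j k l - D i j k l|)
    ⟨i, j, k, l, hi, hi', hj, hj', hk, hk', hl, hl', a i j k l, Or.inl rfl, rfl⟩)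
  have hηx : |η x - C i j k l| ≤ |η (a i j k l) - C i j k l| := by
    rw [hC]
    exact abs_sub_midpoint_le (hη _ _ hax) (hη _ _ hxb)
  have hfx : |f x - D i j k l| ≤ |f (a i j k l) - D i j k l| := by
    rw [hD]
    exact abs_sub_midpoint_le (hf _ _ hax) (hf _ _ hxb)
  calc |η x - f x|
      ≤ |η x - C i j k l| + |C i j k l - f x| := abs_sub_le _ _ _
    _ ≤ |η x - C i j k l| + (|C i j k l - D i j k l| + |D i j k l - f x|) := by
        gcongr
        exact abs_sub_le _ _ _
    _ ≤ _ := by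
        rw [abs_sub_comm (D i j k l)]
        linarith
end

section
/- Let L̄, δ, η, N ∈ ℝ with 10^{δ/10} < 10^{L̄/10}. Suppose (i) the energetic error bound 10^{η/10} ≤ 10^{N/10} + 10^{δ/10} holds, and (ii) N satisfies the δ-tightened threshold N ≤ 10·log₁₀( 10^{L̄/10} − 10^{δ/10} ). Then η ≤ L̄. -/
/-- Soundness of threshold tightening: if the true noise `η` exceeds the
prediction `N` by at most `δ` in the energetic sense, and `N` satisfies the
`δ`-tightened threshold, then `η` satisfies the original threshold `L̄`. -/
theorem stmt11 (Lbar δ η N : ℝ)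
    (hδ : (10 : ℝ) ^ (δ / 10) < (10 : ℝ) ^ (Lbar / 10))
    (h1 : (10 : ℝ) ^ (η / 10) ≤ (10 : ℝ) ^ (N / 10) + (10 : ℝ) ^ (δ / 10))
    (h2 : N ≤ 10 * Real.logb 10 ((10 : ℝ) ^ (Lbar / 10) - (10 : ℝ) ^ (δ / 10))) :
    η ≤ Lbar := by
  have hN : (10 : ℝ) ^ (N / 10) ≤ (10 : ℝ) ^ (Lbar / 10) - (10 : ℝ) ^ (δ / 10) :=
    (Real.le_logb_iff_rpow_le (by norm_num) (sub_pos.mpr hδ)).mp (by linarith)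
  have hη : (10 : ℝ) ^ (η / 10) ≤ (10 : ℝ) ^ (Lbar / 10) := by linarith
  have := (Real.rpow_le_rpow_left_iff (by norm_num)).mp hη
  linarith
end
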